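/- (Proposition F.2) Let G be an IMM_sc-consistent execution graph and ⟨C, I⟩ a traversal configuration of G. If there exist C' and I' such that G ⊢ ⟨C, I⟩ →_STC ⟨C', I'⟩ (a small traversal step), then there exist C'' and I'' such that G ⊢ ⟨C, I⟩ → ⟨C'', I''⟩ (a full traversal step). -/

import Mathlib

/-! ## Basic definitions: events, labels, relations -/

abbrev Loc := ℕ
abbrev Val := ℕ

inductive Mode
  | rlx | acq | rel | acqrel | sc
deriving DecidableEq

inductive ExFlag
  | notex | ex
deriving DecidableEq

inductive Strength
  | normal | strong
deriving DecidableEq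

inductive Label
  | read (o : Mode) (x : Loc) (v : Val) (s : ExFlag)
  | write (o : Mode) (x : Loc) (v : Val) (st : Strength)
  | fence (o : Mode)
deriving DecidableEq

inductive Event
  | init (x : Loc)
  | ev (tid : ℕ) (sn : ℚ)
deriving DecidableEq

def Event.isInit : Event → Prop
  | .init _ => True
  | .ev _ _ => False

/-- the set of initialization events -/
def InitE : Set Event := {e | e.isInit}

/-- the `sequenced-before` partial order on events: initialization events precede all
non-initialization events, and events of the same thread are ordered by serial number -/
def evLt : Event → Event → Prop
  | .init _, .ev _ _ => True
  | .ev i n, .ev j m => i = j ∧ n < m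
  | _, _ => False

abbrev REv := Event → Event → Prop

/-- relational composition `r ; s` -/
def seqR (r s : REv) : REv := fun a c => ∃ b, r a b ∧ s b c

infixr:70 " ⬝ " => seqR

/-- identity relation on a set: `[A]` -/
def eqv (A : Set Event) : REv := fun a b => a = b ∧ a ∈ A

notation:max "⦗" A "⦘" => eqv A

/-- union of relations -/
def runion (r s : REv) : REv := fun a b => r a b ∨ s a b

infixl:65 " ∪ᵣ " => runion

/-- reflexive closure `r^?` -/
def rcl (r : REv) : REv := fun a b => a = b ∨ r a b

/-- transitive closure `r⁺` -/
def tcl (r : REv) : REv := Relation.TransGen r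

/-- reflexive-transitive closure `r*` -/
def rtcl (r : REv) : REv := Relation.ReflTransGen r

/-- inverse relation `r⁻¹` -/
def transp (r : REv) : REv := fun a b => r b a

def rdom (r : REv) : Set Event := {a | ∃ b, r a b}

def rcodom (r : REv) : Set Event := {b | ∃ a, r a b}

/-- immediate edges: `imm(r) = r ∖ r;r` -/
def immediate (r : REv) : REv := fun a b => r a b ∧ ¬ (r ⬝ r) a b

def acyclic (r : REv) : Prop := Irreflexive (tcl r)

/-- `r` totally orders `A` -/
def totalOn (A : Set Event) (r : REv) : Prop :=
  ∀ a ∈ A, ∀ b ∈ A, a ≠ b → r a b ∨ r b a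

def Label.locOf : Label → Option Loc
  | .read _ x _ _ => some x
  | .write _ x _ _ => some x
  | .fence _ => none

def Label.valOf : Label → Option Val
  | .read _ _ v _ => some v
  | .write _ _ v _ => some v
  | .fence _ => none

/-! ## IMM execution graphs -/

structure Execution where
  E : Set Event
  lab : Event → Label
  rmw : REv
  data : REv
  addr : REv
  ctrl : REv
  casdep : REv
  rf : REv
  co : REv

namespace Execution

variable (G : Execution)

def loc (e : Event) : Option Loc := (G.lab e).locOf
def valu (e : Event) : Option Val := (G.lab e).valOf

/-- read events -/
def R : Set Event := {e | e ∈ G.E ∧ ∃ o x v s, G.lab e = .read o x v s}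
/-- write events -/
def W : Set Event := {e | e ∈ G.E ∧ ∃ o x v st, G.lab e = .write o x v st}
/-- fence events -/
def F : Set Event := {e | e ∈ G.E ∧ ∃ o, G.lab e = .fence o}
/-- acquire reads -/
def Racq : Set Event := {e | e ∈ G.E ∧ ∃ x v s, G.lab e = .read .acq x v s}
/-- exclusive reads -/
def Rex : Set Event := {e | e ∈ G.E ∧ ∃ o x v, G.lab e = .read o x v .ex}
/-- release writes -/
def Wrel : Set Event := {e | e ∈ G.E ∧ ∃ x v st, G.lab e = .write .rel x v st}
/-- strong writes -/
def Wstrong : Set Event := {e | e ∈ G.E ∧ ∃ o x v, G.lab e = .write o x v .strong}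
/-- writes to location `x` -/
def Wloc (x : Loc) : Set Event := {e | e ∈ G.W ∧ G.loc e = some x}
/-- reads from location `x` -/
def Rloc (x : Loc) : Set Event := {e | e ∈ G.R ∧ G.loc e = some x}
/-- SC fences -/
def Fsc : Set Event := {e | e ∈ G.E ∧ G.lab e = .fence .sc}
/-- fences of mode exactly `rel` -/
def Frel : Set Event := {e | e ∈ G.E ∧ G.lab e = .fence .rel}
/-- fences whose mode is at least `rel` (i.e. `rel`, `acqrel` or `sc`) -/
def FgeRel : Set Event :=
  {e | e ∈ G.E ∧ (G.lab e = .fence .rel ∨ G.lab e = .fence .acqrel ∨ G.lab e = .fence .sc)}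
/-- fences whose mode is at least `acq` (i.e. `acq`, `acqrel` or `sc`) -/
def FgeAcq : Set Event :=
  {e | e ∈ G.E ∧ (G.lab e = .fence .acq ∨ G.lab e = .fence .acqrel ∨ G.lab e = .fence .sc)}

/-- program order -/
def po : REv := fun a b => a ∈ G.E ∧ b ∈ G.E ∧ evLt a b

/-- both events access the same location -/
def sameLoc : REv := fun a b => ∃ x, G.loc a = some x ∧ G.loc b = some x

/-- `po|loc` -/
def poloc : REv := fun a b => G.po a b ∧ G.sameLoc a b

def rfi : REv := fun a b => G.rf a b ∧ G.po a b
def rfe : REv := fun a b => G.rf a b ∧ ¬ G.po a b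
def coi : REv := fun a b => G.co a b ∧ G.po a b
def coe : REv := fun a b => G.co a b ∧ ¬ G.po a b

/-- from-read -/
def fr : REv := transp G.rf ⬝ G.co
def fri : REv := fun a b => G.fr a b ∧ G.po a b
def fre : REv := fun a b => G.fr a b ∧ ¬ G.po a b

/-- release sequence -/
def rs : REv :=
  ⦗G.W⦘ ⬝ G.poloc ⬝ ⦗G.W⦘ ∪ᵣ ⦗G.W⦘ ⬝ rtcl (rcl G.poloc ⬝ G.rf ⬝ G.rmw)

/-- release prefix -/
def release : REv := (⦗G.Wrel⦘ ∪ᵣ ⦗G.FgeRel⦘ ⬝ G.po) ⬝ G.rs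

/-- synchronizes with -/
def sw : REv :=
  G.release ⬝ (G.rfi ∪ᵣ rcl G.poloc ⬝ G.rfe) ⬝ (⦗G.Racq⦘ ∪ᵣ G.po ⬝ ⦗G.FgeAcq⦘)

/-- happens-before -/
def hb : REv := tcl (G.po ∪ᵣ G.sw)

/-- extended coherence order -/
def eco : REv := G.rf ∪ᵣ G.co ⬝ rcl G.rf ∪ᵣ G.fr ⬝ rcl G.rf

/-- barrier order -/
def bob : REv :=
  G.po ⬝ ⦗G.Wrel⦘ ∪ᵣ ⦗G.Racq⦘ ⬝ G.po ∪ᵣ G.po ⬝ ⦗G.F⦘ ∪ᵣ ⦗G.F⦘ ⬝ G.po ∪ᵣ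
    ⦗G.Wrel⦘ ⬝ G.poloc ⬝ ⦗G.W⦘

/-- syntactic dependencies -/
def deps : REv :=
  G.data ∪ᵣ G.ctrl ∪ᵣ G.addr ⬝ rcl G.po ∪ᵣ G.casdep ∪ᵣ ⦗G.Rex⦘ ⬝ G.po

/-- preserved program order -/
def ppo : REv := ⦗G.R⦘ ⬝ tcl (G.deps ∪ᵣ G.rfi) ⬝ ⦗G.W⦘

def detour : REv := fun a b => (G.coe ⬝ G.rfe) a b ∧ G.po a b

/-- partial SC fence order -/
def psc : REv := ⦗G.Fsc⦘ ⬝ G.hb ⬝ G.eco ⬝ G.hb ⬝ ⦗G.Fsc⦘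

/-- the acyclicity relation of IMM -/
def ar : REv :=
  G.rfe ∪ᵣ G.bob ∪ᵣ G.ppo ∪ᵣ G.detour ∪ᵣ G.psc ∪ᵣ ⦗G.Wstrong⦘ ⬝ G.po ⬝ ⦗G.W⦘

/-! RC11-style variants -/

def rsRC11 : REv := ⦗G.W⦘ ⬝ rcl G.poloc ⬝ rtcl (G.rf ⬝ G.rmw)

def releaseRC11 : REv := (⦗G.Wrel⦘ ∪ᵣ ⦗G.FgeRel⦘ ⬝ G.po) ⬝ G.rsRC11

def swRC11 : REv := G.releaseRC11 ⬝ G.rf ⬝ (⦗G.Racq⦘ ∪ᵣ G.po ⬝ ⦗G.FgeAcq⦘)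

def hbRC11 : REv := tcl (G.po ∪ᵣ G.swRC11)

end Execution

/-- Well-formedness of an IMM execution graph -/
structure ExecWf (G : Execution) : Prop where
  finE : G.E.Finite
  init_lab : ∀ x, Event.init x ∈ G.E →
    G.lab (Event.init x) = Label.write .rlx x 0 .normal
  read_mode : ∀ e ∈ G.E, ∀ o x v s, G.lab e = .read o x v s → o = Mode.rlx ∨ o = Mode.acq
  write_mode : ∀ e ∈ G.E, ∀ o x v st, G.lab e = .write o x v st → o = Mode.rlx ∨ o = Mode.rel
  fence_mode : ∀ e ∈ G.E, ∀ o, G.lab e = .fence o →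
    o = Mode.acq ∨ o = Mode.rel ∨ o = Mode.acqrel ∨ o = Mode.sc
  rmw_sub : ∀ a b, G.rmw a b → a ∈ G.Rex ∧ b ∈ G.W ∧ G.sameLoc a b ∧ immediate G.po a b
  strong_rmw : G.Wstrong ⊆ rcodom G.rmw
  data_sub : ∀ a b, G.data a b → a ∈ G.R ∧ G.po a b ∧ b ∈ G.W
  addr_sub : ∀ a b, G.addr a b → a ∈ G.R ∧ G.po a b ∧ (b ∈ G.R ∨ b ∈ G.W)
  ctrl_sub : ∀ a b, G.ctrl a b → a ∈ G.R ∧ G.po a b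
  ctrl_po : ∀ a b c, G.ctrl a b → G.po b c → G.ctrl a c
  casdep_sub : ∀ a b, G.casdep a b → a ∈ G.R ∧ G.po a b ∧ b ∈ G.Rex
  rf_sub : ∀ a b, G.rf a b → a ∈ G.W ∧ b ∈ G.R ∧ G.sameLoc a b
  rf_val : ∀ a b, G.rf a b → G.valu a = G.valu b
  rf_func : ∀ a b c, G.rf a c → G.rf b c → a = b
  co_sub : ∀ a b, G.co a b → a ∈ G.W ∧ b ∈ G.W ∧ G.sameLoc a b
  co_trans : Transitive G.co
  co_irr : Irreflexive G.co

/-- IMM-consistency (Definition 3.1) -/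
def IMMConsistent (G : Execution) : Prop :=
  rcodom G.rf = G.R ∧
  (∀ x, totalOn (G.Wloc x) G.co) ∧
  Irreflexive (G.hb ⬝ rcl G.eco) ∧
  (∀ a b, G.rmw a b → ¬ (G.fre ⬝ G.coe) a b) ∧
  acyclic G.ar

/-! ## IMM with a total order on SC fences (IMM_sc) -/

/-- `sc` is a strict total order on the SC fences of `G` -/
def scWf (G : Execution) (sc : REv) : Prop :=
  (∀ a b, sc a b → a ∈ G.Fsc ∧ b ∈ G.Fsc) ∧
  Transitive sc ∧ Irreflexive sc ∧ totalOn G.Fsc sc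

/-- `ar_sc`: the acyclicity relation of IMM with `psc` replaced by `sc` -/
def arSC (G : Execution) (sc : REv) : REv :=
  G.rfe ∪ᵣ G.bob ∪ᵣ G.ppo ∪ᵣ G.detour ∪ᵣ sc ∪ᵣ ⦗G.Wstrong⦘ ⬝ G.po ⬝ ⦗G.W⦘

/-- IMM_sc-consistency (the variant using `hb_RC11`). -/
def IMMscConsistent (G : Execution) (sc : REv) : Prop :=
  rcodom G.rf = G.R ∧
  (∀ x, totalOn (G.Wloc x) G.co) ∧
  Irreflexive (G.hbRC11 ⬝ rcl G.eco) ∧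
  (∀ a b, G.rmw a b → ¬ (G.fre ⬝ G.coe) a b) ∧
  acyclic (arSC G sc) ∧
  Irreflexive (sc ⬝ G.hbRC11 ⬝ rcl (G.eco ⬝ G.hbRC11))

/-! ## Full traversal -/

/-- Issuable events (full model). -/
def FIssuable (G : Execution) (C I : Set Event) : Set Event :=
  {w | w ∈ G.W ∧
    (∀ a, (⦗G.Wrel⦘ ⬝ G.poloc ∪ᵣ ⦗G.F⦘ ⬝ G.po) a w → a ∈ C) ∧
    (∀ a, ((G.detour ∪ᵣ G.rfe) ⬝ G.ppo) a w → a ∈ I) ∧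
    (∀ a, ((G.detour ∪ᵣ G.rfe) ⬝ ⦗G.Racq⦘ ⬝ G.po) a w → a ∈ I) ∧
    (∀ a, (⦗G.Wstrong⦘ ⬝ G.po) a w → a ∈ I)}

/-- Coverable events (full model). -/
def FCoverable (G : Execution) (sc : REv) (C I : Set Event) : Set Event :=
  {e | e ∈ G.E ∧ (∀ a, G.po a e → a ∈ C) ∧
    ((e ∈ G.W ∧ e ∈ I) ∨
     (e ∈ G.R ∧ ∀ a, G.rf a e → a ∈ I) ∨
     (e ∈ G.F ∧ e ∉ G.Fsc) ∨
     (e ∈ G.Fsc ∧ ∀ a, sc a e → a ∈ C))}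

/-- `⟨C, I⟩` is a traversal configuration of `G`. -/
def TravConfig (G : Execution) (sc : REv) (C I : Set Event) : Prop :=
  G.E ∩ InitE ⊆ C ∧
  C ⊆ FCoverable G sc C I ∧
  I ⊆ FIssuable G C I ∧
  C ∩ G.W ⊆ I ∧
  I ∩ G.Wrel ⊆ C ∧
  rcodom (⦗C⦘ ⬝ G.rmw) ⊆ C

/-- The (full) traversal steps of Figure 8. -/
inductive TravStep (G : Execution) (sc : REv) :
    Set Event × Set Event → Set Event × Set Event → Prop
  | issue {C I : Set Event} {w : Event} :
      w ∈ FIssuable G C I → w ∉ G.Wrel → w ∉ I →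
      TravStep G sc (C, I) (C, insert w I)
  | cover {C I : Set Event} {e : Event} :
      e ∈ FCoverable G sc C I → (∀ b, ¬ G.rmw e b) → e ∉ C →
      TravStep G sc (C, I) (insert e C, I)
  | releaseCover {C I : Set Event} {w : Event} :
      w ∈ G.Wrel → (∀ a, G.po a w → a ∈ C) → w ∉ C → w ∉ I →
      TravStep G sc (C, I) (insert w C, insert w I)
  | rmwCover {C I I' : Set Event} {r w : Event} :
      r ∈ FCoverable G sc C I → G.rmw r w → r ∉ C → w ∉ C →
      ((w ∈ I ∧ I' = I) ∨ (w ∈ G.Wrel ∧ w ∉ I ∧ I' = insert w I)) →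
      TravStep G sc (C, I) (insert r (insert w C), I')

/-- Small traversal steps. -/
inductive STCStep (G : Execution) (sc : REv) :
    Set Event × Set Event → Set Event × Set Event → Prop
  | cover {C I : Set Event} {a : Event} :
      a ∈ FCoverable G sc C I → a ∉ C → STCStep G sc (C, I) (insert a C, I)
  | issue {C I : Set Event} {w : Event} :
      w ∈ FIssuable G C I → w ∉ I → STCStep G sc (C, I) (C, insert w I)

theorem evLt_irrefl (a : Event) : ¬ evLt a a := by
  cases a <;> simp [evLt]

theorem evLt_trans {a b c : Event} (hab : evLt a b) (hbc : evLt b c) : evLt a c := by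
  cases a <;> cases b <;> cases c <;> simp only [evLt] at *
  exact ⟨hab.1.trans hbc.1, hab.2.trans hbc.2⟩

/-- A finite nonempty set has a minimal element for every acyclic relation. -/
theorem exists_minimal_of_acyclic {r : REv} (hr : acyclic r) {S : Set Event} (hfin : S.Finite)
    (hne : S.Nonempty) : ∃ m ∈ S, ∀ a ∈ S, ¬ tcl r a m := by
  have : IsStrictOrder Event (Relation.TransGen r) :=
    { irrefl := hr, trans := fun _ _ _ => Relation.TransGen.trans }
  obtain ⟨x, hx⟩ := hne
  have hwf : S.WellFoundedOn (Relation.TransGen r) := hfin.wellFoundedOn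
  obtain ⟨m, -, hm⟩ := hwf.has_min Set.univ ⟨⟨x, hx⟩, trivial⟩
  exact ⟨m, m.2, fun a ha h => hm ⟨a, ha⟩ trivial h⟩

namespace Execution

variable {G : Execution}

theorem po_trans {a b c : Event} (hab : G.po a b) (hbc : G.po b c) : G.po a c :=
  ⟨hab.1, hbc.2.1, evLt_trans hab.2.2 hbc.2.2⟩

theorem tcl_subset_po {r : REv} (hr : ∀ a b, r a b → G.po a b) {a b : Event}
    (h : tcl r a b) : G.po a b := by
  induction h with
  | single h => exact hr _ _ h
  | tail _ h ih => exact po_trans ih (hr _ _ h)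

theorem po_acyclic : acyclic G.po := fun a h =>
  evLt_irrefl a (tcl_subset_po (fun _ _ => id) h).2.2

theorem exists_po_minimal (hfin : G.E.Finite) {S : Set Event} (hS : S ⊆ G.E)
    (hne : S.Nonempty) : ∃ m ∈ S, ∀ a, G.po a m → a ∉ S := by
  obtain ⟨m, hm, hmin⟩ := exists_minimal_of_acyclic (po_acyclic (G := G)) (hfin.subset hS) hne
  exact ⟨m, hm, fun a h ha => hmin a ha (.single h)⟩

theorem R_or_W_or_F {e : Event} (he : e ∈ G.E) : e ∈ G.R ∨ e ∈ G.W ∨ e ∈ G.F := by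
  cases h : G.lab e with
  | read o x v s => exact .inl ⟨he, o, x, v, s, h⟩
  | write o x v s => exact .inr (.inl ⟨he, o, x, v, s, h⟩)
  | fence o => exact .inr (.inr ⟨he, o, h⟩)

theorem Wrel_subset_W {e : Event} (h : e ∈ G.Wrel) : e ∈ G.W := by
  obtain ⟨he, x, v, s, hl⟩ := h
  exact ⟨he, _, x, v, s, hl⟩

theorem Wstrong_subset_W {e : Event} (h : e ∈ G.Wstrong) : e ∈ G.W := by
  obtain ⟨he, o, x, v, hl⟩ := h
  exact ⟨he, o, x, v, _, hl⟩

theorem Rex_subset_R {e : Event} (h : e ∈ G.Rex) : e ∈ G.R := by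
  obtain ⟨he, o, x, v, hl⟩ := h
  exact ⟨he, o, x, v, _, hl⟩

theorem notMem_W_of_mem_R {e : Event} (h : e ∈ G.R) : e ∉ G.W := by
  obtain ⟨_, _, _, _, _, h⟩ := h
  rintro ⟨_, _, _, _, _, h'⟩
  simp [h] at h'

theorem notMem_F_of_mem_R {e : Event} (h : e ∈ G.R) : e ∉ G.F := by
  obtain ⟨_, _, _, _, _, h⟩ := h
  rintro ⟨_, _, h'⟩
  simp [h] at h'

end Execution

namespace ExecWf

open Execution

variable {G : Execution}

theorem deps_subset_po (hwf : ExecWf G) {a b : Event} (h : G.deps a b) : G.po a b := by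
  rcases h with (((h | h) | ⟨c, h, rfl | h'⟩) | h) | ⟨_, ⟨rfl, _⟩, h⟩
  · exact (hwf.data_sub _ _ h).2.1
  · exact (hwf.ctrl_sub _ _ h).2
  · exact (hwf.addr_sub _ _ h).2.1
  · exact po_trans (hwf.addr_sub _ _ h).2.1 h'
  · exact (hwf.casdep_sub _ _ h).2.1
  · exact h

theorem ppo_subset_po (hwf : ExecWf G) {a b : Event} (h : G.ppo a b) : G.po a b := by
  obtain ⟨_, ⟨rfl, _⟩, _, h, rfl, _⟩ := h
  exact tcl_subset_po (fun _ _ h => h.elim hwf.deps_subset_po And.right) h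

theorem detour_or_rfe_dom (hwf : ExecWf G) {a b : Event} (h : (G.detour ∪ᵣ G.rfe) a b) :
    a ∈ G.W := by
  rcases h with ⟨⟨c, h, -⟩, -⟩ | h
  · exact (hwf.co_sub _ _ h.1).1
  · exact (hwf.rf_sub _ _ h.1).1

theorem detour_or_rfe_codom (hwf : ExecWf G) {a b : Event} (h : (G.detour ∪ᵣ G.rfe) a b) :
    b ∈ G.R := by
  rcases h with ⟨⟨c, -, h⟩, -⟩ | h <;> exact (hwf.rf_sub _ _ h.1).2.1

/-- The read of an RMW pair immediately precedes its write, so it is the `po`-greatest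
predecessor of the write. -/
theorem eq_or_po_of_rmw (hwf : ExecWf G) {r w b : Event} (h : G.rmw r w) (hb : G.po b w) :
    b = r ∨ G.po b r := by
  obtain ⟨hr, -, -, hrw, himm⟩ := hwf.rmw_sub _ _ h
  have hno : ¬ G.po r b := fun hrb => himm ⟨b, hrb, hb⟩
  cases r with
  | init x =>
    obtain ⟨he, _, _, _, hl⟩ := hr
    simp [hwf.init_lab x he] at hl
  | ev i n =>
    cases w with
    | init x => exact hrw.2.2.elim
    | ev j m =>
      cases b with
      | init x => exact .inr ⟨hb.1, hrw.1, trivial⟩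
      | ev k l =>
        obtain ⟨hbE, -, rfl, hlm⟩ := hb
        obtain ⟨hrE, -, rfl, hnm⟩ := hrw
        rcases lt_trichotomy l n with hlt | rfl | hlt
        · exact .inr ⟨hbE, hrE, rfl, hlt⟩
        · exact .inl rfl
        · exact (hno ⟨hrE, hbE, rfl, hlt⟩).elim

end ExecWf

namespace TravConfig

open Execution

variable {G : Execution} {sc : REv} {C I : Set Event}

/-- Every source of a `detour` or external `rf` edge into a coverable event is issued. -/
theorem mem_I_of_detour_or_rfe (hwf : ExecWf G) (htc : TravConfig G sc C I) {a r : Event}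
    (hr : r ∈ FCoverable G sc C I) (h : (G.detour ∪ᵣ G.rfe) a r) : a ∈ I := by
  have haW := hwf.detour_or_rfe_dom h
  have hrR := hwf.detour_or_rfe_codom h
  rcases h with ⟨-, h⟩ | h
  · exact htc.2.2.2.1 ⟨hr.2.1 a h, haW⟩
  · rcases hr.2.2 with h' | h' | h' | h'
    · exact (notMem_W_of_mem_R hrR h'.1).elim
    · exact h'.2 a h.1
    · exact (notMem_F_of_mem_R hrR h'.1).elim
    · exact (notMem_F_of_mem_R hrR ⟨h'.1.1, _, h'.1.2⟩).elim

/-- A write is issuable when all its `po`-predecessors are coverable and those that are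
writes or fences are covered. -/
theorem mem_FIssuable (hwf : ExecWf G) (htc : TravConfig G sc C I) {w : Event} (hw : w ∈ G.W)
    (hcov : ∀ a, G.po a w → a ∈ FCoverable G sc C I)
    (hmem : ∀ a, G.po a w → a ∉ G.R → a ∈ C) : w ∈ FIssuable G C I := by
  refine ⟨hw, ?_, ?_, ?_, ?_⟩
  · rintro a (⟨_, ⟨rfl, ha⟩, h, -⟩ | ⟨_, ⟨rfl, ha⟩, h⟩)
    · exact hmem a h fun hR => notMem_W_of_mem_R hR (Wrel_subset_W ha)
    · exact hmem a h fun hR => notMem_F_of_mem_R hR ha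
  · rintro a ⟨r, hr, h⟩
    exact htc.mem_I_of_detour_or_rfe hwf (hcov r (hwf.ppo_subset_po h)) hr
  · rintro a ⟨r, hr, _, ⟨rfl, -⟩, h⟩
    exact htc.mem_I_of_detour_or_rfe hwf (hcov r h) hr
  · rintro a ⟨_, ⟨rfl, ha⟩, h⟩
    have haW := Wstrong_subset_W ha
    exact htc.2.2.2.1 ⟨hmem a h fun hR => notMem_W_of_mem_R hR haW, haW⟩

/-- An uncovered coverable event enables a full traversal step. -/
theorem exists_step_of_coverable (hwf : ExecWf G) (htc : TravConfig G sc C I) {e : Event}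
    (he : e ∈ FCoverable G sc C I) (heC : e ∉ C) :
    ∃ C'' I'', TravStep G sc (C, I) (C'', I'') := by
  by_cases hrmw : ∃ w, G.rmw e w
  · obtain ⟨w, hw⟩ := hrmw
    obtain ⟨hex, hwW, -, hpo, -⟩ := hwf.rmw_sub _ _ hw
    have hwC : w ∉ C := fun h => heC ((htc.2.1 h).2.1 e hpo)
    by_cases hwI : w ∈ I
    · exact ⟨_, _, .rmwCover he hw heC hwC (.inl ⟨hwI, rfl⟩)⟩
    by_cases hrel : w ∈ G.Wrel
    · exact ⟨_, _, .rmwCover he hw heC hwC (.inr ⟨hrel, hwI, rfl⟩)⟩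
    refine ⟨_, _, .issue (htc.mem_FIssuable hwf hwW ?_ ?_) hrel hwI⟩
    · intro a ha
      rcases hwf.eq_or_po_of_rmw hw ha with rfl | h
      · exact he
      · exact htc.2.1 (he.2.1 a h)
    · intro a ha haR
      rcases hwf.eq_or_po_of_rmw hw ha with rfl | h
      · exact (haR (Rex_subset_R hex)).elim
      · exact he.2.1 a h
  · exact ⟨_, _, .cover he (not_exists.mp hrmw) heC⟩

/-- A read is coverable once its `po`-predecessors are covered and its external `rf`-source
is issued. -/
theorem read_mem_FCoverable (hwf : ExecWf G) (htc : TravConfig G sc C I) {e : Event}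
    (he : e ∈ G.R) (hpo : ∀ a, G.po a e → a ∈ C) (hrfe : ∀ a, G.rfe a e → a ∈ I) :
    e ∈ FCoverable G sc C I := by
  refine ⟨he.1, hpo, .inr (.inl ⟨he, fun a ha => ?_⟩)⟩
  by_cases h : G.po a e
  · exact htc.2.2.2.1 ⟨hpo a h, (hwf.rf_sub _ _ ha).1⟩
  · exact hrfe a ⟨ha, h⟩

/-- A configuration that does not cover the whole graph enables a full traversal step. -/
theorem exists_step_of_not_covered (hwf : ExecWf G) (hcons : IMMscConsistent G sc)
    (hsc : scWf G sc) (htc : TravConfig G sc C I) (hne : (G.E \ C).Nonempty) :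
    ∃ C'' I'', TravStep G sc (C, I) (C'', I'') := by
  have hcovered {e : Event} (hmin : ∀ a, G.po a e → a ∉ G.E \ C) :
      ∀ a, G.po a e → a ∈ C := fun a ha => by_contra fun h => hmin a ha ⟨ha.1, h⟩
  by_cases hU : ((G.W \ I) ∪ (G.F \ C)).Nonempty
  swap
  · have hW : ∀ a ∈ G.W, a ∈ I := fun a ha => by_contra fun h => hU ⟨a, .inl ⟨ha, h⟩⟩
    obtain ⟨e, ⟨heE, heC⟩, hmin⟩ := exists_po_minimal hwf.finE Set.sdiff_subset hne
    have hpo := hcovered hmin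
    refine htc.exists_step_of_coverable hwf ?_ heC
    rcases R_or_W_or_F heE with h | h | h
    · exact htc.read_mem_FCoverable hwf h hpo fun a ha => hW a (hwf.rf_sub _ _ ha.1).1
    · exact ⟨heE, hpo, .inl ⟨h, hW e h⟩⟩
    · exact (hU ⟨e, .inr ⟨h, heC⟩⟩).elim
  have hUE : (G.W \ I) ∪ (G.F \ C) ⊆ G.E := by
    rintro a (h | h) <;> exact h.1.1
  obtain ⟨x, hx, hmin⟩ := exists_minimal_of_acyclic hcons.2.2.2.2.1 (hwf.finE.subset hUE) hU
  have hW : ∀ a ∈ G.W, tcl (arSC G sc) a x → a ∈ I := fun a ha h =>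
    by_contra fun hI => hmin a (.inl ⟨ha, hI⟩) h
  have hF : ∀ a ∈ G.F, tcl (arSC G sc) a x → a ∈ C := fun a ha h =>
    by_contra fun hC => hmin a (.inr ⟨ha, hC⟩) h
  have ar_bob {a b : Event} (h : G.bob a b) : arSC G sc a b :=
    .inl (.inl (.inl (.inl (.inr h))))
  have ar_dr {a b : Event} (h : (G.detour ∪ᵣ G.rfe) a b) : arSC G sc a b :=
    h.elim (fun h => .inl (.inl (.inr h))) (fun h => .inl (.inl (.inl (.inl (.inl h)))))
  by_cases hrlx : x ∈ G.W \ I ∧ x ∉ G.Wrel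
  · obtain ⟨⟨hxW, hxI⟩, hrel⟩ := hrlx
    refine ⟨_, _, .issue ⟨hxW, ?_, ?_, ?_, ?_⟩ hrel hxI⟩
    · rintro a (⟨_, ⟨rfl, ha⟩, h⟩ | ⟨_, ⟨rfl, ha⟩, h⟩)
      · refine htc.2.2.2.2.1 ⟨hW a (Wrel_subset_W ha) (.single (ar_bob ?_)), ha⟩
        exact .inr ⟨a, ⟨rfl, ha⟩, x, h, rfl, hxW⟩
      · exact hF a ha (.single (ar_bob (.inl (.inr ⟨a, ⟨rfl, ha⟩, h⟩))))
    · rintro a ⟨r, hr, h⟩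
      exact hW a (hwf.detour_or_rfe_dom hr)
        (.tail (.single (ar_dr hr)) (.inl (.inl (.inl (.inr h)))))
    · rintro a ⟨r, hr, h⟩
      exact hW a (hwf.detour_or_rfe_dom hr)
        (.tail (.single (ar_dr hr)) (ar_bob (.inl (.inl (.inl (.inr h))))))
    · rintro a ⟨_, ⟨rfl, ha⟩, h⟩
      exact hW a (Wstrong_subset_W ha)
        (.single (.inr ⟨a, ⟨rfl, ha⟩, x, h, rfl, hxW⟩))
  have hx' : (x ∈ G.Wrel ∧ x ∉ I) ∨ (x ∈ G.F ∧ x ∉ C) := by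
    rcases hx with h | h
    · exact .inl ⟨by_contra fun h' => hrlx ⟨h, h'⟩, h.2⟩
    · exact .inr h
  have hxC : x ∉ C := by
    rcases hx' with h | h
    · exact fun hC => h.2 (htc.2.2.2.1 ⟨hC, Wrel_subset_W h.1⟩)
    · exact h.2
  have hbar {e : Event} (h : G.po e x) : arSC G sc e x := by
    rcases hx' with h' | h'
    · exact ar_bob (.inl (.inl (.inl (.inl ⟨x, h, rfl, h'.1⟩))))
    · exact ar_bob (.inl (.inl (.inr ⟨x, h, rfl, h'.1⟩)))
  by_cases hpre : ∀ a, G.po a x → a ∈ C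
  · rcases hx' with ⟨hrel, hxI⟩ | ⟨hxF, -⟩
    · exact ⟨_, _, .releaseCover hrel hpre hxC hxI⟩
    · refine htc.exists_step_of_coverable hwf ⟨hxF.1, hpre, ?_⟩ hxC
      by_cases hxsc : x ∈ G.Fsc
      · refine .inr (.inr (.inr ⟨hxsc, fun a ha => ?_⟩))
        obtain ⟨haE, hal⟩ := (hsc.1 a x ha).1
        exact hF a ⟨haE, _, hal⟩ (.single (.inl (.inr ha)))
      · exact .inr (.inr (.inl ⟨hxF, hxsc⟩))
  · push Not at hpre
    obtain ⟨b, hb, hbC⟩ := hpre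
    obtain ⟨e, ⟨hex, heC⟩, hemin⟩ := exists_po_minimal (S := {a | G.po a x ∧ a ∉ C}) hwf.finE
      (fun _ h => h.1.1) ⟨b, hb, hbC⟩
    have hpo : ∀ a, G.po a e → a ∈ C := fun a ha =>
      by_contra fun h => hemin a ha ⟨po_trans ha hex, h⟩
    refine htc.exists_step_of_coverable hwf ?_ heC
    rcases R_or_W_or_F hex.1 with h | h | h
    · exact htc.read_mem_FCoverable hwf h hpo fun a ha =>
        hW a (hwf.rf_sub _ _ ha.1).1 (.tail (.single (ar_dr (.inr ha))) (hbar hex))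
    · exact ⟨hex.1, hpo, .inl ⟨h, hW e h (.single (hbar hex))⟩⟩
    · exact (heC (hF e h (.single (hbar hex)))).elim

end TravConfig

/-- Proposition F.2: if there is a small traversal step from a
traversal configuration of an IMM_sc-consistent execution graph, then there is a
full traversal step from it. -/
theorem small_step_implies_full_step (G : Execution) (sc : REv)
    (hwf : ExecWf G) (hsc : scWf G sc) (hcons : IMMscConsistent G sc)
    (C I : Set Event) (htc : TravConfig G sc C I)
    (hstep : ∃ C' I', STCStep G sc (C, I) (C', I')) :
    ∃ C'' I'', TravStep G sc (C, I) (C'', I'') := by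
  refine htc.exists_step_of_not_covered hwf hcons hsc ?_
  obtain ⟨C', I', h⟩ := hstep
  cases h with
  | cover h hC => exact ⟨_, h.1, hC⟩
  | issue h hI => exact ⟨_, h.1.1, fun hC => hI (htc.2.2.2.1 ⟨hC, h.1⟩)⟩
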